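/- Let p be a prime and r ≥ 2 an integer. Let M = [[a, b],[c, d]] ∈ GL₂(ℚ_p) have all entries in ℤ_p with min{v_p(a), v_p(b), v_p(c), v_p(d)} = 0, and suppose v_p(b) < v_p(a) < v_p(b) + r and v_p(d) < v_p(c) < v_p(d) + r. Then there exists a diagonal matrix t = diag(u, w) with u, w ∈ ℤ_p^× (in particular t ∈ Γ₀(p^r ℤ_p)) such that: if v_p(d) ≥ v_p(b), then M·t = [[p^{v_p(a)}, 1],[γ, δ]] for some γ, δ ∈ ℤ_p with v_p(γ) = v_p(c) and v_p(δ) = v_p(d); and if v_p(d) < v_p(b), then M·t = [[α, β],[p^{v_p(c)}, 1]] for some α, β ∈ ℤ_p with v_p(α) = v_p(a) and v_p(β) = v_p(b). -/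

import Mathlib

open Matrix Classical

/-- A matrix over `ℚ_p` lies in `Γ₀(p^r ℤ_p)`: all entries in `ℤ_p`, determinant a unit,
and lower-left entry in `p^r ℤ_p`. -/
def Gamma0 (p : ℕ) [Fact p.Prime] (r : ℕ) (M : Matrix (Fin 2) (Fin 2) ℚ_[p]) : Prop :=
  (∀ i j, ‖M i j‖ ≤ 1) ∧ ‖M.det‖ = 1 ∧ ‖M 1 0‖ ≤ (p : ℝ) ^ (-(r : ℤ))

/-- The `p`-adic valuation on `ℚ_p` with the convention `v_p(0) = +∞`. -/
noncomputable def vp (p : ℕ) [Fact p.Prime] (x : ℚ_[p]) : WithTop ℤ :=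
  if x = 0 then ⊤ else (x.valuation : WithTop ℤ)


theorem vp_le_vp_iff (p : ℕ) [Fact p.Prime] (x y : ℚ_[p]) : vp p x ≤ vp p y ↔ ‖y‖ ≤ ‖x‖ := by
  have hp : (1 : ℝ) < p := mod_cast (Fact.out : p.Prime).one_lt
  by_cases hy : y = 0
  · simp [vp, hy]
  by_cases hx : x = 0
  · simp [vp, hx, hy]
  rw [Padic.norm_eq_zpow_neg_valuation hx, Padic.norm_eq_zpow_neg_valuation hy,
    zpow_le_zpow_iff_right₀ hp]
  simp [vp, hx, hy]

theorem vp_lt_vp_iff (p : ℕ) [Fact p.Prime] (x y : ℚ_[p]) : vp p x < vp p y ↔ ‖y‖ < ‖x‖ := by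
  simpa only [not_le] using (vp_le_vp_iff p y x).not

theorem vp_mul_of_norm_eq_one (p : ℕ) [Fact p.Prime] (x u : ℚ_[p]) (hu : ‖u‖ = 1) :
    vp p (x * u) = vp p x := by
  apply le_antisymm <;> simp [vp_le_vp_iff, hu]

theorem ne_zero_of_vp_lt (p : ℕ) [Fact p.Prime] (x : ℚ_[p]) (t : WithTop ℤ) (h : vp p x < t) :
    x ≠ 0 := by
  rintro rfl
  simp [vp] at h

theorem exists_unit_mul_eq_zpow_valuation (p : ℕ) [Fact p.Prime] (x : ℚ_[p]) (hx : x ≠ 0) :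
    ∃ u : ℚ_[p], ‖u‖ = 1 ∧ x * u = (p : ℚ_[p]) ^ x.valuation := by
  refine ⟨(p : ℚ_[p]) ^ x.valuation / x, ?_, mul_div_cancel₀ _ hx⟩
  rw [norm_div, Padic.norm_p_zpow, ← Padic.norm_eq_zpow_neg_valuation hx,
    div_self (norm_ne_zero_iff.mpr hx)]

theorem exists_unit_mul_eq_one (p : ℕ) [Fact p.Prime] (x : ℚ_[p]) (hx : ‖x‖ = 1) :
    ∃ w : ℚ_[p], ‖w‖ = 1 ∧ x * w = 1 :=
  ⟨x⁻¹, by simp [hx], mul_inv_cancel₀ (norm_ne_zero_iff.mp (by simp [hx]))⟩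

/-- the reduction algorithm, case `v_p(b) < v_p(a) < v_p(b) + r` and
`v_p(d) < v_p(c) < v_p(d) + r`: a diagonal unit matrix reduces `M` to one of two
normal shapes, according to whether `v_p(d) ≥ v_p(b)` or `v_p(d) < v_p(b)`. -/
theorem reduction_case_middle_middle (p : ℕ) [Fact p.Prime] (r : ℕ) (hr : 2 ≤ r)
    (a b c d : ℚ_[p]) (M : Matrix (Fin 2) (Fin 2) ℚ_[p]) (hM : M = !![a, b; c, d])
    (hdet : M.det ≠ 0)
    (hint : ∀ i j, ‖M i j‖ ≤ 1) (hmin : ∃ i j, ‖M i j‖ = 1)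
    (hba : vp p b < vp p a) (har : vp p a < vp p b + ((r : ℤ) : WithTop ℤ))
    (hdc : vp p d < vp p c) (hcr : vp p c < vp p d + ((r : ℤ) : WithTop ℤ)) :
    ∃ u w : ℚ_[p], ‖u‖ = 1 ∧ ‖w‖ = 1 ∧
      ((vp p b ≤ vp p d →
        ∃ va : ℤ, vp p a = (va : WithTop ℤ) ∧
          ∃ γ δ : ℚ_[p], ‖γ‖ ≤ 1 ∧ ‖δ‖ ≤ 1 ∧ vp p γ = vp p c ∧ vp p δ = vp p d ∧
            M * !![u, 0; 0, w] = !![(p : ℚ_[p]) ^ va, 1; γ, δ]) ∧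
      (vp p d < vp p b →
        ∃ vc : ℤ, vp p c = (vc : WithTop ℤ) ∧
          ∃ α β : ℚ_[p], ‖α‖ ≤ 1 ∧ ‖β‖ ≤ 1 ∧ vp p α = vp p a ∧ vp p β = vp p b ∧
            M * !![u, 0; 0, w] = !![α, β; (p : ℚ_[p]) ^ vc, 1])) := by
  subst hM
  have ha0 := ne_zero_of_vp_lt p a _ har
  have hc0 := ne_zero_of_vp_lt p c _ hcr
  rw [vp_lt_vp_iff] at hba hdc
  simp only [Fin.forall_fin_two, Fin.exists_fin_two, of_apply, cons_val', cons_val_zero,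
    cons_val_one, cons_val_fin_one] at hint hmin
  obtain ⟨⟨ha, hb⟩, hc, hd⟩ := hint
  simp only [vp_le_vp_iff, vp_lt_vp_iff]
  rcases le_or_gt ‖d‖ ‖b‖ with h | h
  · have hb1 : ‖b‖ = 1 := by
      rcases hmin with (h1 | h1) | (h1 | h1) <;> linarith
    obtain ⟨u, hu, hau⟩ := exists_unit_mul_eq_zpow_valuation p a ha0
    obtain ⟨w, hw, hbw⟩ := exists_unit_mul_eq_one p b hb1
    refine ⟨u, w, hu, hw, fun _ => ⟨a.valuation, by simp [vp, ha0], c * u, d * w, by simpa [hu],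
      by simpa [hw], vp_mul_of_norm_eq_one p c u hu, vp_mul_of_norm_eq_one p d w hw, ?_⟩,
      fun h' => absurd h h'.not_ge⟩
    simp [hau, hbw]
  · have hd1 : ‖d‖ = 1 := by
      rcases hmin with (h1 | h1) | (h1 | h1) <;> linarith
    obtain ⟨u, hu, hcu⟩ := exists_unit_mul_eq_zpow_valuation p c hc0
    obtain ⟨w, hw, hdw⟩ := exists_unit_mul_eq_one p d hd1
    refine ⟨u, w, hu, hw, fun h' => absurd h h'.not_gt, fun _ => ⟨c.valuation, by simp [vp, hc0],
      a * u, b * w, by simpa [hu], by simpa [hw], vp_mul_of_norm_eq_one p a u hu,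
      vp_mul_of_norm_eq_one p b w hw, ?_⟩⟩
    simp [hcu, hdw]
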